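/- Let σ > 0 and define h(μ) = ∫_ℝ Φ(x)·(1/(√(2π)·σ))·exp( −(x−μ)²/(2σ²) ) dx for μ ∈ ℝ. Then h(0) = 1/2 and h is differentiable on ℝ with h′(μ) = (1/√(2π·(1+σ²)))·exp( −μ²/(2(1+σ²)) ) for every μ ∈ ℝ. -/

import Mathlib

open MeasureTheory Real

/-- The standard normal cumulative distribution function. -/
noncomputable def stdNormalCDF (x : ℝ) : ℝ :=
  ∫ t in Set.Iic x, (1 / Real.sqrt (2 * Real.pi)) * Real.exp (-t^2 / 2)

open ProbabilityTheory in
/-- The standard normal cumulative distribution function is the measure of `Iic x` under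
`gaussianReal 0 1`. -/
theorem stdNormalCDF_eq_gaussianReal_real_Iic (x : ℝ) :
    stdNormalCDF x = (gaussianReal 0 1).real (Set.Iic x) := by
  rw [measureReal_def, gaussianReal_apply_eq_integral 0 one_ne_zero, ENNReal.toReal_ofReal
    (integral_nonneg fun t => gaussianPDFReal_nonneg 0 1 t), stdNormalCDF]
  simp [gaussianPDFReal_def]

/-- If `X ∼ ρ` and `Y ∼ ν` are independent, then `E[P(Y ≤ X)] = P(Y - X ≤ 0)`. -/
theorem integral_measureReal_Iic (ρ ν : Measure ℝ) [IsFiniteMeasure ρ] [IsFiniteMeasure ν] :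
    ∫ x, ν.real (Set.Iic x) ∂ρ = ((ρ.map fun x => -x).conv ν).real (Set.Iic 0) := by
  have hmono : Monotone fun x => ν (Set.Iic x) :=
    fun a b hab => measure_mono (Set.Iic_subset_Iic.2 hab)
  simp only [measureReal_def]
  rw [integral_toReal hmono.measurable.aemeasurable (ae_of_all _ fun x => measure_lt_top ν _),
    Measure.conv, Measure.map_apply measurable_add measurableSet_Iic,
    Measure.prod_apply (measurable_add measurableSet_Iic),
    lintegral_map (measurable_measure_prodMk_left (measurable_add measurableSet_Iic))
      measurable_neg]
  congr! 4 with x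
  ext y
  simp

open ProbabilityTheory in
/-- The expectation of the cumulative distribution function of a centered Gaussian under another
Gaussian. -/
theorem integral_gaussianReal_real_Iic (μ : ℝ) (v w : NNReal) :
    ∫ x, (gaussianReal 0 w).real (Set.Iic x) ∂(gaussianReal μ v)
      = (gaussianReal 0 (v + w)).real (Set.Iic μ) := by
  have hshift : gaussianReal (-μ) (v + w) = (gaussianReal 0 (v + w)).map (· + -μ) := by
    rw [gaussianReal_map_add_const, zero_add]
  rw [integral_measureReal_Iic, gaussianReal_map_neg, gaussianReal_conv_gaussianReal, add_zero,
    hshift, map_measureReal_apply (by fun_prop) measurableSet_Iic]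
  congr 1
  ext y
  simp

open ProbabilityTheory in
/-- A nondegenerate centered Gaussian gives mass `1 / 2` to the nonpositive half-line. -/
theorem gaussianReal_real_Iic_zero {v : NNReal} (hv : v ≠ 0) :
    (gaussianReal 0 v).real (Set.Iic 0) = 1 / 2 := by
  have := nullSingletonClass_gaussianReal (μ := 0) hv
  have hsymm : (gaussianReal 0 v).real (Set.Ioi 0) = (gaussianReal 0 v).real (Set.Iic 0) := by
    conv_rhs => rw [← neg_zero (G := ℝ), ← gaussianReal_map_neg,
      map_measureReal_apply measurable_neg measurableSet_Iic]
    rw [measureReal_congr Ioi_ae_eq_Ici]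
    congr 1
    ext y
    simp
  have hcompl := probReal_compl_eq_one_sub (μ := gaussianReal 0 v)
    (measurableSet_Iic (a := (0 : ℝ)))
  rw [Set.compl_Iic] at hcompl
  linarith

/-- The fundamental theorem of calculus for integrals over `Iic x`. -/
theorem MeasureTheory.Integrable.hasDerivAt_integral_Iic {f : ℝ → ℝ} (hf : Integrable f)
    (hc : Continuous f) (x : ℝ) : HasDerivAt (fun u => ∫ t in Set.Iic u, f t) (f x) x := by
  have heq : (fun u => ∫ t in Set.Iic u, f t)
      = fun u => (∫ t in Set.Iic 0, f t) + ∫ t in (0)..u, f t := by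
    ext u
    rw [← intervalIntegral.integral_Iic_sub_Iic hf.integrableOn hf.integrableOn]
    ring
  rw [heq]
  exact (hc.integral_hasStrictDerivAt 0 x).hasDerivAt.const_add _

open ProbabilityTheory in
/-- The density of a nondegenerate Gaussian is the derivative of its distribution function. -/
theorem hasDerivAt_gaussianReal_real_Iic (m : ℝ) {v : NNReal} (hv : v ≠ 0) (x : ℝ) :
    HasDerivAt (fun u => (gaussianReal m v).real (Set.Iic u)) (gaussianPDFReal m v x) x := by
  have heq : (fun u => (gaussianReal m v).real (Set.Iic u))
      = fun u => ∫ t in Set.Iic u, gaussianPDFReal m v t := by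
    ext u
    rw [measureReal_def, gaussianReal_apply_eq_integral m hv, ENNReal.toReal_ofReal
      (integral_nonneg fun t => gaussianPDFReal_nonneg m v t)]
  rw [heq]
  refine (integrable_gaussianPDFReal m v).hasDerivAt_integral_Iic ?_ x
  rw [gaussianPDFReal_def]
  fun_prop

/-- For `σ > 0`, the function `h(μ) = ∫ Φ(x) N(μ,σ²)(x) dx` satisfies `h(0) = 1/2` and is
differentiable with `h′(μ) = (1/√(2π(1+σ²))) exp(−μ²/(2(1+σ²)))`. -/
theorem deriv_expectation_cdf_of_gaussian (σ : ℝ) (hσ : 0 < σ)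
    (h : ℝ → ℝ)
    (hdef : ∀ μ : ℝ, h μ = ∫ x : ℝ, stdNormalCDF x
        * ((1 / (Real.sqrt (2 * Real.pi) * σ)) * Real.exp (-(x - μ)^2 / (2 * σ^2)))) :
    h 0 = 1/2 ∧
    ∀ μ : ℝ, HasDerivAt h
      ((1 / Real.sqrt (2 * Real.pi * (1 + σ^2))) * Real.exp (-μ^2 / (2 * (1 + σ^2)))) μ := by
  obtain ⟨v, hvσ⟩ : ∃ v : NNReal, (v : ℝ) = σ ^ 2 := ⟨⟨σ ^ 2, sq_nonneg σ⟩, rfl⟩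
  have hv : v ≠ 0 := by
    rw [← NNReal.coe_ne_zero, hvσ]
    positivity
  have hv1 : v + 1 ≠ 0 := by positivity
  have hh : h = fun μ => (ProbabilityTheory.gaussianReal 0 (v + 1)).real (Set.Iic μ) := by
    ext μ
    rw [hdef, ← integral_gaussianReal_real_Iic,
      ProbabilityTheory.integral_gaussianReal_eq_integral_smul hv]
    congr 1 with x
    rw [stdNormalCDF_eq_gaussianReal_real_Iic, ProbabilityTheory.gaussianPDFReal_def, smul_eq_mul,
      hvσ, Real.sqrt_mul (by positivity) (σ ^ 2), Real.sqrt_sq hσ.le, one_div, mul_comm]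
  refine ⟨by rw [hh]; exact gaussianReal_real_Iic_zero hv1, fun μ => ?_⟩
  rw [hh]
  convert hasDerivAt_gaussianReal_real_Iic 0 hv1 μ using 1
  simp [ProbabilityTheory.gaussianPDFReal_def, hvσ, add_comm]
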